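/- In the kernel ridge regression setup with a bounded kernel, i.e. k(z,z) ≤ 1 for all z ∈ Z, let w ≥ 1 divide T and fix a sequence z_1,…,z_T ∈ Z; for each t let σ_t² denote the uncertainty estimate built from the first t points (σ_0²(z) = k(z,z)) and σ_t := √(σ_t²). Let Γ_T ≥ (1/2) log det(I + ρ⁻¹ K_T), where K_T is the kernel matrix of z_1,…,z_T, and let Γ' ≥ 0 be any real such that for every subsequence of (z_1,…,z_T) of length T/w the information gain (1/2) log det(I + ρ⁻¹ K) is at most Γ'. Then the sum of delayed standard deviations satisfies Σ_{t=1}^{T} σ_{w⌊(t−1)/w⌋}(z_t) ≤ √( (2 Γ_T / log(1 + 1/ρ)) · ( T + 2 w² Γ' / log(1 + 1/ρ) ) ). -/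

import Mathlib

/- Kernel ridge regression setup: `Z` a nonempty set, `H` a real Hilbert space,
`φ : Z → H` a feature map, kernel `k(z,z') = ⟪φ z, φ z'⟫`. -/

open scoped RealInnerProductSpace
open Matrix

/-- The `n × n` kernel (Gram) matrix of the points `zs`. -/
noncomputable def gramM {Z H : Type*} [NormedAddCommGroup H] [InnerProductSpace ℝ H]
    (φ : Z → H) {n : ℕ} (zs : Fin n → Z) : Matrix (Fin n) (Fin n) ℝ :=
  Matrix.of fun i j => ⟪φ (zs i), φ (zs j)⟫

/-- The vector `k_n(z) = (k(z, z_1), …, k(z, z_n))`. -/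
noncomputable def kvec {Z H : Type*} [NormedAddCommGroup H] [InnerProductSpace ℝ H]
    (φ : Z → H) {n : ℕ} (zs : Fin n → Z) (z : Z) : Fin n → ℝ :=
  fun i => ⟪φ z, φ (zs i)⟫

/-- The kernel ridge regression weight vector `α_n(z) = (K_n + ρ I)⁻¹ k_n(z)`. -/
noncomputable def ridgeWeights {Z H : Type*} [NormedAddCommGroup H] [InnerProductSpace ℝ H]
    (φ : Z → H) {n : ℕ} (zs : Fin n → Z) (ρ : ℝ) (z : Z) : Fin n → ℝ :=
  (gramM φ zs + ρ • (1 : Matrix (Fin n) (Fin n) ℝ))⁻¹ *ᵥ kvec φ zs z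

/-- The kernel ridge uncertainty estimate
`σ_n²(z) = k(z,z) − k_n(z)ᵀ (K_n + ρ I)⁻¹ k_n(z)`. -/
noncomputable def ridgeVar {Z H : Type*} [NormedAddCommGroup H] [InnerProductSpace ℝ H]
    (φ : Z → H) {n : ℕ} (zs : Fin n → Z) (ρ : ℝ) (z : Z) : ℝ :=
  ⟪φ z, φ z⟫ -
    kvec φ zs z ⬝ᵥ ((gramM φ zs + ρ • (1 : Matrix (Fin n) (Fin n) ℝ))⁻¹ *ᵥ kvec φ zs z)

section RidgeLemmas

variable {Z H : Type*} [NormedAddCommGroup H] [InnerProductSpace ℝ H]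

theorem Finset.one_add_sum_le_prod_one_add_of_nonneg {ι : Type*} (s : Finset ι) (f : ι → ℝ)
    (hf : ∀ i, 0 ≤ f i) : 1 + ∑ i ∈ s, f i ≤ ∏ i ∈ s, (1 + f i) := by
  classical
  induction s using Finset.induction_on with
  | empty => simp
  | insert a s ha ih =>
    rw [Finset.sum_insert ha, Finset.prod_insert ha]
    nlinarith [hf a, mul_nonneg (hf a) (Finset.sum_nonneg fun i (_ : i ∈ s) => hf i)]

theorem Matrix.PosSemidef.one_add_trace_le_det_one_add {n : Type*} [Fintype n] [DecidableEq n]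
    {M : Matrix n n ℝ} (hM : M.PosSemidef) : 1 + M.trace ≤ (1 + M).det := by
  have hdet : (1 + M).det = ∏ i, (1 + hM.isHermitian.eigenvalues i) := by
    have h := Matrix.eval_charpoly M (-1)
    rw [hM.isHermitian.charpoly_eq, Polynomial.eval_prod] at h
    have h2 : Matrix.scalar n (-1 : ℝ) - M = -(1 + M) := by
      rw [map_neg, map_one]; abel
    rw [h2, Matrix.det_neg] at h
    have h3 : ∏ i, Polynomial.eval (-1 : ℝ)
        (Polynomial.X - Polynomial.C ((hM.isHermitian.eigenvalues i : ℝ)))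
        = (-1) ^ Fintype.card n * ∏ i, (1 + hM.isHermitian.eigenvalues i) := by
      rw [Fintype.card, ← Finset.prod_const, ← Finset.prod_mul_distrib]
      refine Finset.prod_congr rfl fun i _ => ?_
      simp; ring
    exact mul_left_cancel₀ (pow_ne_zero _ (by norm_num)) (h.symm.trans h3)
  rw [hdet, hM.isHermitian.trace_eq_sum_eigenvalues]
  exact Finset.one_add_sum_le_prod_one_add_of_nonneg _ _ hM.eigenvalues_nonneg

theorem gramM_posSemidef (φ : Z → H) {n : ℕ} (zs : Fin n → Z) : (gramM φ zs).PosSemidef :=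
  Matrix.posSemidef_gram ℝ fun i => φ (zs i)

theorem gramM_add_smul_one_posDef (φ : Z → H) {n : ℕ} (zs : Fin n → Z) {ρ : ℝ} (hρ : 0 < ρ) :
    (gramM φ zs + ρ • (1 : Matrix (Fin n) (Fin n) ℝ)).PosDef :=
  Matrix.PosDef.posSemidef_add (gramM_posSemidef φ zs) (Matrix.PosDef.one.smul hρ)

theorem one_add_smul_gramM_posDef (φ : Z → H) {n : ℕ} (zs : Fin n → Z) {ρ : ℝ} (hρ : 0 < ρ) :
    (1 + ρ⁻¹ • gramM φ zs).PosDef :=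
  Matrix.PosDef.one.add_posSemidef ((gramM_posSemidef φ zs).smul (inv_pos.2 hρ).le)

/-- The cross-kernel matrix of two lists of points. -/
noncomputable def crossGram (φ : Z → H) {n m : ℕ} (zs : Fin n → Z) (ws : Fin m → Z) :
    Matrix (Fin n) (Fin m) ℝ :=
  Matrix.of fun i a => ⟪φ (zs i), φ (ws a)⟫

/-- The ridge covariance matrix of the points `ws` given the points `zs`. -/
noncomputable def ridgeCov (φ : Z → H) {n m : ℕ} (zs : Fin n → Z) (ρ : ℝ) (ws : Fin m → Z) :
    Matrix (Fin m) (Fin m) ℝ :=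
  gramM φ ws - (crossGram φ zs ws)ᴴ *
    (gramM φ zs + ρ • (1 : Matrix (Fin n) (Fin n) ℝ))⁻¹ * crossGram φ zs ws

theorem ridgeCov_diag (φ : Z → H) {n m : ℕ} (zs : Fin n → Z) (ρ : ℝ) (ws : Fin m → Z)
    (a : Fin m) : ridgeCov φ zs ρ ws a a = ridgeVar φ zs ρ (ws a) := by
  have h : kvec φ zs (ws a) = fun i => crossGram φ zs ws i a := by
    ext i; simp [kvec, crossGram, real_inner_comm]
  rw [ridgeVar, h, ridgeCov, Matrix.mul_assoc]
  simp [gramM, Matrix.mul_apply, dotProduct, mulVec]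

theorem gramM_append (φ : Z → H) {n m : ℕ} (zs : Fin n → Z) (ws : Fin m → Z) :
    (gramM φ (Fin.append zs ws)).submatrix finSumFinEquiv finSumFinEquiv =
      Matrix.fromBlocks (gramM φ zs) (crossGram φ zs ws) (crossGram φ zs ws)ᴴ (gramM φ ws) := by
  ext (i | i) (j | j) <;> simp [gramM, crossGram, real_inner_comm]

theorem ridgeCov_posSemidef (φ : Z → H) {n m : ℕ} (zs : Fin n → Z) {ρ : ℝ} (hρ : 0 < ρ)
    (ws : Fin m → Z) : (ridgeCov φ zs ρ ws).PosSemidef := by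
  have hA := gramM_add_smul_one_posDef φ zs hρ
  have := hA.isUnit.invertible
  rw [ridgeCov, ← Matrix.PosDef.fromBlocks₁₁ _ _ hA]
  have hdiag : (Matrix.fromBlocks (ρ • (1 : Matrix (Fin n) (Fin n) ℝ)) 0 0
      (0 : Matrix (Fin m) (Fin m) ℝ)).PosSemidef := by
    have : Matrix.fromBlocks (ρ • (1 : Matrix (Fin n) (Fin n) ℝ)) 0 0
        (0 : Matrix (Fin m) (Fin m) ℝ) = Matrix.diagonal (Sum.elim (fun _ => ρ) fun _ => 0) := by
      rw [Matrix.smul_one_eq_diagonal, ← Matrix.diagonal_zero, Matrix.fromBlocks_diagonal]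
    rw [this]
    refine Matrix.PosSemidef.diagonal ?_
    rintro (i | i)
    · exact hρ.le
    · exact le_rfl
  have hG := (gramM_posSemidef φ (Fin.append zs ws)).submatrix finSumFinEquiv
  rw [gramM_append] at hG
  simpa [Matrix.fromBlocks_add] using hG.add hdiag

theorem det_one_add_smul_gramM_append (φ : Z → H) {n m : ℕ} (zs : Fin n → Z) {ρ : ℝ} (hρ : 0 < ρ)
    (ws : Fin m → Z) :
    (1 + ρ⁻¹ • gramM φ (Fin.append zs ws)).det =
      (1 + ρ⁻¹ • gramM φ zs).det * (1 + ρ⁻¹ • ridgeCov φ zs ρ ws).det := by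
  have hA := one_add_smul_gramM_posDef φ zs hρ
  have := hA.isUnit.invertible
  have hinv : (1 + ρ⁻¹ • gramM φ zs)⁻¹ =
      ρ • (gramM φ zs + ρ • (1 : Matrix (Fin n) (Fin n) ℝ))⁻¹ := by
    refine Matrix.inv_eq_right_inv ?_
    have h : 1 + ρ⁻¹ • gramM φ zs = ρ⁻¹ • (gramM φ zs + ρ • (1 : Matrix (Fin n) (Fin n) ℝ)) := by
      rw [smul_add, smul_smul, inv_mul_cancel₀ hρ.ne', one_smul, add_comm]
    rw [h, Matrix.smul_mul, Matrix.mul_smul, smul_smul, inv_mul_cancel₀ hρ.ne', one_smul,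
      Matrix.mul_nonsing_inv _
        ((Matrix.isUnit_iff_isUnit_det _).1 (gramM_add_smul_one_posDef φ zs hρ).isUnit)]
  have hblock : (1 + ρ⁻¹ • gramM φ (Fin.append zs ws)).submatrix finSumFinEquiv finSumFinEquiv =
      Matrix.fromBlocks (1 + ρ⁻¹ • gramM φ zs) (ρ⁻¹ • crossGram φ zs ws)
        (ρ⁻¹ • (crossGram φ zs ws)ᴴ) (1 + ρ⁻¹ • gramM φ ws) := by
    rw [Matrix.submatrix_add, Pi.add_apply, Pi.add_apply, Matrix.submatrix_one_equiv,
      Matrix.submatrix_smul, Pi.smul_apply, Pi.smul_apply, gramM_append, Matrix.fromBlocks_smul,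
      ← Matrix.fromBlocks_one, Matrix.fromBlocks_add, zero_add, zero_add]
  rw [← Matrix.det_submatrix_equiv_self finSumFinEquiv, hblock, Matrix.det_fromBlocks₁₁,
    Matrix.invOf_eq_nonsing_inv, hinv]
  congr 2
  rw [ridgeCov, Matrix.smul_mul, Matrix.mul_smul, Matrix.mul_smul, smul_smul,
    inv_mul_cancel₀ hρ.ne', one_smul, smul_sub, add_sub_assoc]

theorem log_det_add_log_le (φ : Z → H) {n m : ℕ} (zs : Fin n → Z) {ρ : ℝ} (hρ : 0 < ρ)
    (ws : Fin m → Z) :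
    Real.log (1 + ρ⁻¹ • gramM φ zs).det + Real.log (1 + (∑ a, ridgeVar φ zs ρ (ws a)) / ρ) ≤
      Real.log (1 + ρ⁻¹ • gramM φ (Fin.append zs ws)).det := by
  have hC := (ridgeCov_posSemidef φ zs hρ ws).smul (inv_pos.2 hρ).le
  have htr : (ρ⁻¹ • ridgeCov φ zs ρ ws).trace = (∑ a, ridgeVar φ zs ρ (ws a)) / ρ := by
    rw [Matrix.trace_smul, smul_eq_mul, div_eq_inv_mul]
    simp only [Matrix.trace, Matrix.diag_apply, ridgeCov_diag]
  have h1 := hC.one_add_trace_le_det_one_add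
  have h0 := hC.trace_nonneg
  rw [htr] at h1 h0
  rw [det_one_add_smul_gramM_append φ zs hρ ws,
    Real.log_mul (one_add_smul_gramM_posDef φ zs hρ).det_pos.ne' (by linarith)]
  gcongr

theorem ridgeVar_nonneg (φ : Z → H) {n : ℕ} (zs : Fin n → Z) {ρ : ℝ} (hρ : 0 < ρ) (z : Z) :
    0 ≤ ridgeVar φ zs ρ z := by
  simpa [ridgeCov_diag] using (ridgeCov_posSemidef φ zs hρ fun _ : Fin 1 => z).diag_nonneg (i := 0)

/-- The regularized least-squares objective whose minimum over `α` is the ridge variance. -/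
noncomputable def ridgeLoss (φ : Z → H) {n : ℕ} (zs : Fin n → Z) (ρ : ℝ) (z : Z)
    (α : Fin n → ℝ) : ℝ :=
  ‖φ z - ∑ i, α i • φ (zs i)‖ ^ 2 + ρ * ∑ i, α i ^ 2

theorem ridgeLoss_eq (φ : Z → H) {n : ℕ} (zs : Fin n → Z) (ρ : ℝ) (z : Z) (α : Fin n → ℝ) :
    ridgeLoss φ zs ρ z α = ⟪φ z, φ z⟫ - 2 * (α ⬝ᵥ kvec φ zs z) +
      α ⬝ᵥ ((gramM φ zs + ρ • (1 : Matrix (Fin n) (Fin n) ℝ)) *ᵥ α) := by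
  have h1 : ⟪φ z, ∑ i, α i • φ (zs i)⟫ = α ⬝ᵥ kvec φ zs z := by
    simp [inner_sum, inner_smul_right, dotProduct, kvec]
  have h2 : ‖∑ i, α i • φ (zs i)‖ ^ 2 = α ⬝ᵥ (gramM φ zs *ᵥ α) := by
    rw [← real_inner_self_eq_norm_sq]
    simp only [sum_inner, inner_sum, inner_smul_left, inner_smul_right, dotProduct, mulVec, gramM,
      Matrix.of_apply, Finset.mul_sum]
    refine Finset.sum_congr rfl fun i _ => Finset.sum_congr rfl fun j _ => ?_
    rw [conj_trivial, real_inner_comm]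
    ring
  rw [ridgeLoss, norm_sub_sq_real, h1, h2, ← real_inner_self_eq_norm_sq, Matrix.add_mulVec,
    dotProduct_add, Matrix.smul_mulVec, Matrix.one_mulVec, dotProduct_smul, smul_eq_mul]
  simp only [dotProduct, ← pow_two]
  ring

theorem ridgeLoss_eq_ridgeVar_add (φ : Z → H) {n : ℕ} (zs : Fin n → Z) {ρ : ℝ} (hρ : 0 < ρ) (z : Z)
    (α : Fin n → ℝ) :
    ridgeLoss φ zs ρ z α = ridgeVar φ zs ρ z + (α - ridgeWeights φ zs ρ z) ⬝ᵥ
      ((gramM φ zs + ρ • (1 : Matrix (Fin n) (Fin n) ℝ)) *ᵥ (α - ridgeWeights φ zs ρ z)) := by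
  have hA := gramM_add_smul_one_posDef φ zs hρ
  rw [ridgeLoss_eq, ridgeVar]
  change _ = ⟪φ z, φ z⟫ - kvec φ zs z ⬝ᵥ ridgeWeights φ zs ρ z + _
  have hw : (gramM φ zs + ρ • (1 : Matrix (Fin n) (Fin n) ℝ)) *ᵥ ridgeWeights φ zs ρ z =
      kvec φ zs z := by
    rw [ridgeWeights, Matrix.mulVec_mulVec, Matrix.mul_nonsing_inv _
      ((Matrix.isUnit_iff_isUnit_det _).1 hA.isUnit), Matrix.one_mulVec]
  have hsymm : ridgeWeights φ zs ρ z ⬝ᵥ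
      ((gramM φ zs + ρ • (1 : Matrix (Fin n) (Fin n) ℝ)) *ᵥ α) = α ⬝ᵥ kvec φ zs z := by
    have ht : (gramM φ zs + ρ • (1 : Matrix (Fin n) (Fin n) ℝ))ᵀ =
        gramM φ zs + ρ • (1 : Matrix (Fin n) (Fin n) ℝ) := by
      simpa [Matrix.conjTranspose_eq_transpose_of_trivial] using hA.isHermitian.eq
    rw [Matrix.dotProduct_mulVec, ← Matrix.mulVec_transpose, ht, hw, dotProduct_comm]
  rw [Matrix.mulVec_sub, hw, sub_dotProduct, dotProduct_sub, dotProduct_sub, hsymm,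
    dotProduct_comm (ridgeWeights φ zs ρ z)]
  ring

theorem ridgeVar_le_ridgeLoss (φ : Z → H) {n : ℕ} (zs : Fin n → Z) {ρ : ℝ} (hρ : 0 < ρ) (z : Z)
    (α : Fin n → ℝ) : ridgeVar φ zs ρ z ≤ ridgeLoss φ zs ρ z α := by
  rw [ridgeLoss_eq_ridgeVar_add φ zs hρ z α, le_add_iff_nonneg_right]
  simpa using (gramM_add_smul_one_posDef φ zs hρ).posSemidef.dotProduct_mulVec_nonneg
    (α - ridgeWeights φ zs ρ z)

theorem ridgeVar_le_ridgeVar_comp (φ : Z → H) {m n : ℕ} (zs : Fin n → Z) {ρ : ℝ} (hρ : 0 < ρ)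
    (e : Fin m → Fin n) (he : Function.Injective e) (z : Z) :
    ridgeVar φ zs ρ z ≤ ridgeVar φ (zs ∘ e) ρ z := by
  set α := ridgeWeights φ (zs ∘ e) ρ z with hα
  have hmin : ridgeVar φ (zs ∘ e) ρ z = ridgeLoss φ (zs ∘ e) ρ z α := by
    rw [ridgeLoss_eq_ridgeVar_add φ _ hρ, ← hα, sub_self, zero_dotProduct, add_zero]
  have hsum : ∑ i, α i • φ ((zs ∘ e) i) = ∑ i, Function.extend e α 0 i • φ (zs i) := by
    refine Fintype.sum_of_injective e he _ _ (fun i hi => ?_) fun i => ?_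
    · rw [Function.extend_apply' _ _ _ hi, Pi.zero_apply, zero_smul]
    · rw [he.extend_apply, Function.comp_apply]
  have hsq : ∑ i, α i ^ 2 = ∑ i, Function.extend e α 0 i ^ 2 := by
    refine Fintype.sum_of_injective e he _ _ (fun i hi => ?_) fun i => ?_
    · rw [Function.extend_apply' _ _ _ hi, Pi.zero_apply, zero_pow two_ne_zero]
    · rw [he.extend_apply]
  rw [hmin, ridgeLoss, hsum, hsq]
  exact ridgeVar_le_ridgeLoss φ zs hρ z _

/-- Extending a sequence of points by the next `m` points. -/
theorem log_det_add_log_le_of_seq (φ : Z → H) {ρ : ℝ} (hρ : 0 < ρ) (zseq : ℕ → Z) (n m : ℕ) :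
    Real.log (1 + ρ⁻¹ • gramM φ fun i : Fin n => zseq i).det +
        Real.log (1 + (∑ r ∈ Finset.range m,
          ridgeVar φ (fun i : Fin n => zseq i) ρ (zseq (n + r))) / ρ) ≤
      Real.log (1 + ρ⁻¹ • gramM φ fun i : Fin (n + m) => zseq i).det := by
  have h : (fun i : Fin (n + m) => zseq i) =
      Fin.append (fun i : Fin n => zseq i) fun a : Fin m => zseq (n + a) := by
    ext i
    refine Fin.addCases (fun i => ?_) (fun i => ?_) i <;> simp
  rw [h, Finset.sum_range]
  exact log_det_add_log_le φ _ hρ _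

theorem sum_log_window_le (φ : Z → H) {ρ : ℝ} (hρ : 0 < ρ) (zseq : ℕ → Z) (w n : ℕ) :
    ∑ j ∈ Finset.range n, Real.log (1 + (∑ r ∈ Finset.range w,
        ridgeVar φ (fun i : Fin (w * j) => zseq i) ρ (zseq (w * j + r))) / ρ) ≤
      Real.log (1 + ρ⁻¹ • gramM φ fun i : Fin (w * n) => zseq i).det := by
  induction n with
  | zero => simp
  | succ n ih =>
    rw [Finset.sum_range_succ]
    exact (add_le_add_left ih _).trans (log_det_add_log_le_of_seq φ hρ zseq (w * n) w)

theorem sum_log_le_log_det (φ : Z → H) {ρ : ℝ} (hρ : 0 < ρ) (zseq : ℕ → Z) (n : ℕ) :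
    ∑ j ∈ Finset.range n,
        Real.log (1 + ridgeVar φ (fun i : Fin j => zseq i) ρ (zseq j) / ρ) ≤
      Real.log (1 + ρ⁻¹ • gramM φ fun i : Fin n => zseq i).det := by
  induction n with
  | zero => simp
  | succ n ih =>
    have h := log_det_add_log_le_of_seq φ hρ zseq n 1
    rw [Finset.sum_range_one, add_zero] at h
    rw [Finset.sum_range_succ]
    exact (add_le_add_left ih _).trans h

theorem mul_log_one_add_inv_le {ρ x : ℝ} (hρ : 0 < ρ) (hx0 : 0 ≤ x) (hx1 : x ≤ 1) :
    x * Real.log (1 + 1 / ρ) ≤ Real.log (1 + x / ρ) := by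
  have hp : 0 < 1 / ρ := by positivity
  rw [← Real.log_rpow (by positivity)]
  refine Real.log_le_log (by positivity) ?_
  refine (rpow_one_add_le_one_add_mul_self (by linarith) hx0 hx1).trans_eq ?_
  rw [mul_one_div]

theorem ridgeVar_le_one (φ : Z → H) (hk : ∀ z : Z, ⟪φ z, φ z⟫ ≤ 1) {n : ℕ} (zs : Fin n → Z)
    {ρ : ℝ} (hρ : 0 < ρ) (z : Z) : ridgeVar φ zs ρ z ≤ 1 := by
  refine (ridgeVar_le_ridgeLoss φ zs hρ z 0).trans ?_
  simpa [ridgeLoss] using hk z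

/-- Selecting one point from every window: the delayed variances of the selected points are
controlled by the information gain of the selected subsequence. -/
theorem sum_ridgeVar_selection_le (φ : Z → H) {ρ : ℝ} (hρ : 0 < ρ)
    (hk : ∀ z : Z, ⟪φ z, φ z⟫ ≤ 1) (zseq : ℕ → Z) (w n : ℕ) (r : ℕ → ℕ) (hr : ∀ j, r j < w) :
    (∑ j ∈ Finset.range n,
        ridgeVar φ (fun i : Fin (w * j) => zseq i) ρ (zseq (w * j + r j))) *
          Real.log (1 + 1 / ρ) ≤
      Real.log (1 + ρ⁻¹ • gramM φ fun i : Fin n => zseq (w * i + r i)).det := by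
  refine le_trans ?_ (sum_log_le_log_det φ hρ (fun j => zseq (w * j + r j)) n)
  rw [Finset.sum_mul]
  refine Finset.sum_le_sum fun j _ => ?_
  have hlt (i : Fin j) : w * (i : ℕ) + r i < w * j := by
    nlinarith [hr i, Nat.mul_le_mul_left w (Nat.succ_le_of_lt i.2)]
  have hmono := ridgeVar_le_ridgeVar_comp φ (fun i : Fin (w * j) => zseq i) hρ
    (fun i : Fin j => ⟨w * (i : ℕ) + r i, hlt i⟩) (fun a b hab => ?_) (zseq (w * j + r j))
  · exact (mul_le_mul_of_nonneg_right hmono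
      (Real.log_nonneg (by linarith [show 0 < 1 / ρ by positivity]))).trans
        (mul_log_one_add_inv_le hρ (ridgeVar_nonneg φ _ hρ _) (ridgeVar_le_one φ hk _ hρ _))
  · have hdiv (i : Fin j) : (w * (i : ℕ) + r i) / w = i := by
      rw [Nat.mul_add_div (Nat.zero_lt_of_lt (hr 0)), Nat.div_eq_of_lt (hr i), add_zero]
    have := congrArg (fun k : Fin (w * j) => (k : ℕ) / w) hab
    simpa [hdiv, Fin.ext_iff] using this

/-- The delayed standard deviations in one window of length `w`, with total variance `∑ v` and
maximal variance `D`. -/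
theorem sum_sqrt_window_le {ρ : ℝ} (hρ : 0 < ρ) (w : ℕ) (v : ℕ → ℝ) (D : ℝ)
    (hv : ∀ r, 0 ≤ v r) (hD : ∀ r ∈ Finset.range w, v r ≤ D) (hD0 : 0 ≤ D) :
    ∑ r ∈ Finset.range w, √(v r) ≤
      √(Real.log (1 + (∑ r ∈ Finset.range w, v r) / ρ) / Real.log (1 + 1 / ρ)) *
        √((w : ℝ) + w ^ 2 * D) := by
  set S := ∑ r ∈ Finset.range w, v r
  have hS : 0 ≤ S := Finset.sum_nonneg fun r _ => hv r
  have hL : 0 < Real.log (1 + 1 / ρ) := Real.log_pos (by linarith [show 0 < 1 / ρ by positivity])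
  have hℓ : 0 ≤ Real.log (1 + S / ρ) / Real.log (1 + 1 / ρ) :=
    div_nonneg (Real.log_nonneg (by linarith [show 0 ≤ S / ρ by positivity])) hL.le
  rw [← Real.sqrt_mul hℓ]
  refine Real.le_sqrt_of_sq_le (sq_sum_le_card_mul_sum_sq.trans ?_)
  simp only [Real.sq_sqrt (hv _), Finset.card_range]
  change (w : ℝ) * S ≤ _
  have hw : (0 : ℝ) ≤ w := w.cast_nonneg
  have hwD : 0 ≤ (w : ℝ) ^ 2 * D := by positivity
  rcases le_total S 1 with h1 | h1
  · have h : S ≤ Real.log (1 + S / ρ) / Real.log (1 + 1 / ρ) :=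
      (le_div_iff₀ hL).2 (mul_log_one_add_inv_le hρ hS h1)
    nlinarith [mul_le_mul_of_nonneg_right h hw, mul_nonneg hℓ hwD]
  · have h : 1 ≤ Real.log (1 + S / ρ) / Real.log (1 + 1 / ρ) := by
      rw [le_div_iff₀ hL, one_mul]
      gcongr
    have hSD : S ≤ w * D := by
      simpa using Finset.sum_le_card_nsmul _ _ _ hD
    nlinarith [mul_le_mul_of_nonneg_left hSD hw, mul_nonneg (sub_nonneg.2 h) (add_nonneg hw hwD)]

theorem Finset.sum_range_mul_eq_sum_sum (f : ℕ → ℝ) (w n : ℕ) :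
    ∑ t ∈ Finset.range (w * n), f t =
      ∑ j ∈ Finset.range n, ∑ r ∈ Finset.range w, f (w * j + r) := by
  induction n with
  | zero => simp
  | succ n ih => rw [Nat.mul_succ, Finset.sum_range_add, ih, Finset.sum_range_succ]

end RidgeLemmas

/-- (Lemma 3 of the paper: sum of delayed standard deviations.)
For a bounded kernel (`k(z,z) ≤ 1`), window size `w ≥ 1` dividing `T`,
`Γ_T` an upper bound on the information gain `(1/2) log det(I + ρ⁻¹ K_T)` of the full
sequence, and `Γ' ≥ 0` dominating the information gain of every length-`T/w`
subsequence, the sum of delayed standard deviations satisfies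
`Σ_{t=1}^{T} σ_{w⌊(t−1)/w⌋}(z_t) ≤ √((2Γ_T/log(1+1/ρ)) (T + 2w²Γ'/log(1+1/ρ)))`.
The sequence is 0-indexed: `zseq t` is the paper's `z_{t+1}`. -/
theorem sum_delayed_ridgeStd_le
    {Z H : Type*} [Nonempty Z] [NormedAddCommGroup H] [InnerProductSpace ℝ H]
    (φ : Z → H) (ρ : ℝ) (hρ : 0 < ρ)
    (hk : ∀ z : Z, ⟪φ z, φ z⟫ ≤ 1)
    (T w : ℕ) (hw : 1 ≤ w) (hdvd : w ∣ T) (zseq : ℕ → Z)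
    (ΓT Γ' : ℝ) (hΓ' : 0 ≤ Γ')
    (hΓT : (1 / 2) * Real.log ((1 + ρ⁻¹ • gramM φ (fun i : Fin T => zseq i)).det) ≤ ΓT)
    (hsub : ∀ g : Fin (T / w) → Fin T, StrictMono g →
      (1 / 2) * Real.log ((1 + ρ⁻¹ • gramM φ (fun i => zseq (g i))).det) ≤ Γ') :
    ∑ t ∈ Finset.range T,
        Real.sqrt (ridgeVar φ (fun i : Fin (w * (t / w)) => zseq i) ρ (zseq t))
      ≤ Real.sqrt ((2 * ΓT / Real.log (1 + 1 / ρ)) *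
          ((T : ℝ) + 2 * w ^ 2 * Γ' / Real.log (1 + 1 / ρ))) := by
  obtain ⟨n, rfl⟩ := hdvd
  rw [Nat.mul_div_cancel_left n hw] at hsub
  have hL : 0 < Real.log (1 + 1 / ρ) := Real.log_pos (by linarith [show 0 < 1 / ρ by positivity])
  set v : ℕ → ℕ → ℝ := fun j r =>
    ridgeVar φ (fun i : Fin (w * j) => zseq i) ρ (zseq (w * j + r)) with hv
  have hv0 (j r : ℕ) : 0 ≤ v j r := ridgeVar_nonneg φ _ hρ _
  have hmax (j : ℕ) : ∃ r < w, ∀ s ∈ Finset.range w, v j s ≤ v j r := by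
    obtain ⟨r, hr, h⟩ := Finset.exists_max_image (Finset.range w) (v j) ⟨0, Finset.mem_range.2 hw⟩
    exact ⟨r, Finset.mem_range.1 hr, h⟩
  choose r hr hmax using hmax
  have hlt {i j : ℕ} (hij : i < j) : w * i + r i < w * j := by
    nlinarith [hr i, Nat.mul_le_mul_left w (Nat.succ_le_of_lt hij)]
  have hsel : ∑ j ∈ Finset.range n, v j (r j) ≤ 2 * Γ' / Real.log (1 + 1 / ρ) := by
    rw [le_div_iff₀ hL]
    have h := hsub (fun i => ⟨w * i + r i, hlt i.2⟩) fun i j hij =>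
      (hlt hij).trans_le (Nat.le_add_right _ _)
    linarith [sum_ridgeVar_selection_le φ hρ hk zseq w n r hr]
  have hA : ∑ j ∈ Finset.range n,
      Real.log (1 + (∑ r ∈ Finset.range w, v j r) / ρ) / Real.log (1 + 1 / ρ) ≤
        2 * ΓT / Real.log (1 + 1 / ρ) := by
    rw [← Finset.sum_div]
    gcongr
    linarith [sum_log_window_le φ hρ zseq w n]
  have hB : ∑ j ∈ Finset.range n, ((w : ℝ) + w ^ 2 * v j (r j)) ≤
      ((w * n : ℕ) : ℝ) + 2 * w ^ 2 * Γ' / Real.log (1 + 1 / ρ) := by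
    rw [Finset.sum_add_distrib, ← Finset.mul_sum]
    have h := mul_le_mul_of_nonneg_left hsel (sq_nonneg (w : ℝ))
    simp only [Finset.sum_const, Finset.card_range, nsmul_eq_mul]
    push_cast
    linear_combination h
  have hA0 (j : ℕ) : 0 ≤ Real.log (1 + (∑ r ∈ Finset.range w, v j r) / ρ) /
      Real.log (1 + 1 / ρ) := by
    have : 0 ≤ (∑ r ∈ Finset.range w, v j r) / ρ :=
      div_nonneg (Finset.sum_nonneg fun r _ => hv0 j r) hρ.le
    exact div_nonneg (Real.log_nonneg (by linarith)) hL.le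
  have hB0 (j : ℕ) : 0 ≤ (w : ℝ) + w ^ 2 * v j (r j) := by
    have := hv0 j (r j)
    positivity
  have hsplit : ∑ t ∈ Finset.range (w * n),
      √(ridgeVar φ (fun i : Fin (w * (t / w)) => zseq i) ρ (zseq t)) =
        ∑ j ∈ Finset.range n, ∑ r ∈ Finset.range w, √(v j r) := by
    rw [Finset.sum_range_mul_eq_sum_sum]
    refine Finset.sum_congr rfl fun j _ => Finset.sum_congr rfl fun s hs => ?_
    rw [Nat.mul_add_div hw, Nat.div_eq_of_lt (Finset.mem_range.1 hs), add_zero]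
  rw [hsplit, Real.sqrt_mul ((Finset.sum_nonneg fun j _ => hA0 j).trans hA)]
  calc ∑ j ∈ Finset.range n, ∑ r ∈ Finset.range w, √(v j r)
      ≤ ∑ j ∈ Finset.range n,
          √(Real.log (1 + (∑ r ∈ Finset.range w, v j r) / ρ) / Real.log (1 + 1 / ρ)) *
            √((w : ℝ) + w ^ 2 * v j (r j)) :=
        Finset.sum_le_sum fun j _ =>
          sum_sqrt_window_le hρ w (v j) _ (hv0 j) (hmax j) (hv0 j _)
    _ ≤ _ := Real.sum_sqrt_mul_sqrt_le _ hA0 hB0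
    _ ≤ _ := by gcongr
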